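/- arXiv:1302.5245 — 10 statements merged into one kernel-verified Lean document; each statement's English description precedes it below -/
import Mathlib

section
/- Let e be a tripotent in E and let x, y be elements of the Peirce subspace E₁(e). Then Q(e)({x,y,e}) = {y,x,e}; that is, the sesquilinear map F₁(x,y) := {x,y,e} from E₁(e) × E₁(e) to E₂(e) is hermitian with respect to the involution z ↦ Q(e)z of E₂(e). -/
/-- if `e` is a tripotent and `x, y ∈ E₁(e)`, then
`Q(e)({x,y,e}) = {y,x,e}`, i.e. the sesquilinear map `F₁(x,y) = {x,y,e}` is
hermitian with respect to the involution `z ↦ Q(e)z` of `E₂(e)`. -/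
theorem F_one_hermitian
    {E : Type*} [AddCommGroup E] [Module ℂ E]
    (tp : E → E → E → E)
    (tp_add_left : ∀ x y a b : E, tp (x + y) a b = tp x a b + tp y a b)
    (tp_smul_left : ∀ (c : ℂ) (x a b : E), tp (c • x) a b = c • tp x a b)
    (tp_add_mid : ∀ a x y b : E, tp a (x + y) b = tp a x b + tp a y b)
    (tp_smul_mid : ∀ (c : ℂ) (a x b : E), tp a (c • x) b = (starRingEnd ℂ) c • tp a x b)
    (tp_comm : ∀ x y z : E, tp x y z = tp z y x)
    (tp_jordan : ∀ a b x y z : E, tp a b (tp x y z)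
      = tp (tp a b x) y z - tp x (tp b a y) z + tp x y (tp a b z))
    (e : E) (he : tp e e e = e)
    (x y : E) (hx : tp e e x = (1/2 : ℂ) • x) (hy : tp e e y = (1/2 : ℂ) • y) :
    tp e (tp x y e) e = tp y x e := by
  have hpeirce : tp e e (tp y x e) = tp y x e := by
    have hstar : (starRingEnd ℂ) (1/2 : ℂ) = 1/2 := by
      simpa using Complex.conj_ofNat 2
    rw [tp_jordan, hx, hy, he, tp_smul_left, tp_smul_mid, hstar, sub_self, zero_add]
  have h := tp_jordan y x e e e
  rw [he, tp_comm (tp y x e) e e, hpeirce] at h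
  rw [sub_add_eq_add_sub, eq_sub_iff_add_eq] at h
  exact add_left_cancel h
end

section
/- Let e be a tripotent in E and let a ∈ E₁(e) satisfy {a^[3], e, a^[3]} = 0 and {a^[3], a, e} = 0. Then {a^[3], a, a^[3]} = 0; equivalently (by power associativity) a^[7] = 0. -/
/-- Odd powers in a Jordan triple system: `oddPow tp a n = a^[2n+1]`. -/
def oddPow {E : Type*} (tp : E → E → E → E) (a : E) : ℕ → E
  | 0 => a
  | n + 1 => tp a (oddPow tp a n) a

/-- if `e` is a tripotent, `a ∈ E₁(e)`, `{a^[3], e, a^[3]} = 0` and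
`{a^[3], a, e} = 0`, then `{a^[3], a, a^[3]} = 0`; equivalently (by power
associativity) `a^[7] = 0`. -/
theorem seventh_power_eq_zero
    {E : Type*} [AddCommGroup E] [Module ℂ E]
    (tp : E → E → E → E)
    (tp_add_left : ∀ x y a b : E, tp (x + y) a b = tp x a b + tp y a b)
    (tp_smul_left : ∀ (c : ℂ) (x a b : E), tp (c • x) a b = c • tp x a b)
    (tp_add_mid : ∀ a x y b : E, tp a (x + y) b = tp a x b + tp a y b)
    (tp_smul_mid : ∀ (c : ℂ) (a x b : E), tp a (c • x) b = (starRingEnd ℂ) c • tp a x b)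
    (tp_comm : ∀ x y z : E, tp x y z = tp z y x)
    (tp_jordan : ∀ a b x y z : E, tp a b (tp x y z)
      = tp (tp a b x) y z - tp x (tp b a y) z + tp x y (tp a b z))
    (e : E) (he : tp e e e = e)
    (a : E) (ha : tp e e a = (1/2 : ℂ) • a)
    (h1 : tp (tp a a a) e (tp a a a) = 0)
    (h2 : tp (tp a a a) a e = 0) :
    tp (tp a a a) a (tp a a a) = 0 ∧ oddPow tp a 3 = 0 := by
  have hz_left : ∀ x y : E, tp 0 x y = 0 := fun x y => by
    simpa using tp_smul_left 0 0 x y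
  have hz_right : ∀ x y : E, tp x y 0 = 0 := fun x y => by
    rw [tp_comm, hz_left]
  have key : tp (tp a a a) a (tp a a a) = 0 := by
    have h := tp_jordan e a (tp a a a) e (tp a a a)
    rw [h1, hz_right, tp_comm e a, h2, hz_left, hz_right, tp_comm a e e, ha, tp_smul_mid] at h
    simpa using h
  refine ⟨key, ?_⟩
  simp only [oddPow]
  have h5 : tp (tp a a a) a a = tp a (tp a a a) a := by
    have h := tp_jordan a a a a a
    rw [tp_comm a a (tp a a a)] at h
    linear_combination (norm := module) (-1 : ℂ) • h
  have hq := tp_jordan a a a (tp a a a) a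
  have hr := tp_jordan a (tp a a a) a a a
  have hp := tp_jordan (tp a a a) a a a a
  rw [key] at hp
  simp only [tp_comm a a (tp a a a), h5, tp_comm a a (tp a (tp a a a) a),
    tp_comm a (tp a a a) (tp a a a)] at hq hr hp
  linear_combination (norm := module) (2 / 3 : ℂ) • hq + (4 / 3 : ℂ) • hr - hp
end

section
/- Assume hypotheses (P) and (S) hold for the tripotent e. Let a ∈ E₁(e) with {a,a,e} = 0. Then {a,b,e} = 0 and {b,a,e} = 0 for every b ∈ E₁(e). -/
/-- A polarized Cauchy–Schwarz argument: if `p + c u + c̄ v` is a nonnegative real for all complex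
`c`, then `u = v = 0`. -/
theorem eq_zero_of_forall_add_mul_add_conj_mul_nonneg {p u v : ℂ}
    (h : ∀ c : ℂ, ∃ r : ℝ, 0 ≤ r ∧ p + c * u + (starRingEnd ℂ) c * v = r) :
    u = 0 ∧ v = 0 := by
  have key : ∀ c : ℂ, c * u + (starRingEnd ℂ) c * v = 0 := by
    intro c
    have hr : ∀ t : ℝ, 0 ≤ p.re + t * (c * u + (starRingEnd ℂ) c * v).re ∧
        p.im + t * (c * u + (starRingEnd ℂ) c * v).im = 0 := by
      intro t
      obtain ⟨r, hr, h⟩ := h (t * c)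
      have h' : p + t * (c * u + (starRingEnd ℂ) c * v) = r := by
        rw [← h, map_mul, Complex.conj_ofReal]
        ring
      have hre := congrArg Complex.re h'
      have him := congrArg Complex.im h'
      rw [Complex.add_re, Complex.re_ofReal_mul, Complex.ofReal_re] at hre
      rw [Complex.add_im, Complex.im_ofReal_mul, Complex.ofReal_im] at him
      exact ⟨hre ▸ hr, him⟩
    generalize c * u + (starRingEnd ℂ) c * v = s at hr
    apply Complex.ext
    · by_contra hs
      have hneg := (hr (-(p.re + 1) / s.re)).1
      rw [div_mul_cancel₀ _ hs] at hneg
      linarith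
    · have h0 := (hr 0).2
      have h1 := (hr 1).2
      simp only [Complex.zero_im]
      linarith
  have h1 := key 1
  have hI := key Complex.I
  rw [map_one] at h1
  rw [Complex.conj_I] at hI
  have hsub : u - v = 0 := by
    apply (mul_eq_zero.mp (_ : Complex.I * (u - v) = 0)).resolve_left Complex.I_ne_zero
    linear_combination hI
  constructor
  · linear_combination (h1 + hsub) / 2
  · linear_combination (h1 - hsub) / 2


/-- under hypotheses (P) and (S) for the tripotent `e`, if
`a ∈ E₁(e)` with `{a,a,e} = 0`, then `{a,b,e} = 0` and `{b,a,e} = 0` for every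
`b ∈ E₁(e)`. -/
theorem orthogonality_from_cauchy_schwarz
    {E : Type*} [NormedAddCommGroup E] [NormedSpace ℂ E] [CompleteSpace E]
    (tp : E → E → E → E)
    (tp_add_left : ∀ x y a b : E, tp (x + y) a b = tp x a b + tp y a b)
    (tp_smul_left : ∀ (c : ℂ) (x a b : E), tp (c • x) a b = c • tp x a b)
    (tp_add_mid : ∀ a x y b : E, tp a (x + y) b = tp a x b + tp a y b)
    (tp_smul_mid : ∀ (c : ℂ) (a x b : E), tp a (c • x) b = (starRingEnd ℂ) c • tp a x b)
    (tp_comm : ∀ x y z : E, tp x y z = tp z y x)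
    (tp_jordan : ∀ a b x y z : E, tp a b (tp x y z)
      = tp (tp a b x) y z - tp x (tp b a y) z + tp x y (tp a b z))
    (tp_cont : Continuous fun p : E × E × E => tp p.1 p.2.1 p.2.2)
    (e : E) (he : tp e e e = e)
    (hP : ∀ (x : E) (φ : E →L[ℂ] ℂ), ‖φ‖ = 1 → φ e = 1 →
      ∃ r : ℝ, 0 ≤ r ∧ φ (tp x x e) = (r : ℂ))
    (hS : ∀ z : E, tp e e z = z →
      (∀ φ : E →L[ℂ] ℂ, ‖φ‖ = 1 → φ e = 1 → φ z = 0) → z = 0)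
    (a : E) (ha : tp e e a = (1/2 : ℂ) • a) (haa : tp a a e = 0) :
    ∀ b : E, tp e e b = (1/2 : ℂ) • b → tp a b e = 0 ∧ tp b a e = 0 := by
  intro b hb
  have conj_half : (starRingEnd ℂ) (1/2 : ℂ) = 1/2 := by
    rw [map_div₀, map_one, map_ofNat]
  have peirce_two : ∀ x y : E, tp e e x = (1/2 : ℂ) • x → tp e e y = (1/2 : ℂ) • y →
      tp e e (tp x y e) = tp x y e := by
    intro x y hx hy
    rw [tp_jordan, hx, hy, he, tp_smul_left, tp_smul_mid, conj_half, sub_self, zero_add]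
  have vanish : ∀ φ : E →L[ℂ] ℂ, ‖φ‖ = 1 → φ e = 1 →
      φ (tp a b e) = 0 ∧ φ (tp b a e) = 0 := by
    intro φ hφ hφe
    apply eq_zero_of_forall_add_mul_add_conj_mul_nonneg (p := φ (tp b b e))
    intro c
    obtain ⟨r, hr, h⟩ := hP (b + c • a) φ hφ hφe
    refine ⟨r, hr, ?_⟩
    rw [← h]
    simp only [tp_add_left, tp_add_mid, tp_smul_left, tp_smul_mid, haa, smul_zero, add_zero,
      map_add, map_smul, smul_eq_mul]
    ring
  exact ⟨hS _ (peirce_two a b ha hb) fun φ h1 h2 => (vanish φ h1 h2).1,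
    hS _ (peirce_two b a hb ha) fun φ h1 h2 => (vanish φ h1 h2).2⟩
end

section
/- Let e be a tripotent in E and let a ∈ E₁(e) satisfy {a,a,e} = 0 and {a,b,e} = 0 for every b ∈ E₁(e). Then {c,b,e} = 0 for every b ∈ E₁(e) and every c in the closed subtriple E_a generated by a. -/
/-- The closed subtriple of \`E\` generated by \`a\`: the smallest closed linear
subspace of \`E\` containing \`a\` and closed under the triple product \`tp\`. -/
def closedGenSubtriple {E : Type*} [NormedAddCommGroup E] [NormedSpace ℂ E]
    (tp : E → E → E → E) (a : E) : Set E :=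
  ⋂ V ∈ {V : Submodule ℂ E | a ∈ V ∧ IsClosed (V : Set E) ∧
      ∀ x ∈ V, ∀ y ∈ V, ∀ z ∈ V, tp x y z ∈ V},
    (V : Set E)

/-- if `e` is a tripotent, `a ∈ E₁(e)`, `{a,a,e} = 0` and
`{a,b,e} = 0` for every `b ∈ E₁(e)`, then `{c,b,e} = 0` for every `b ∈ E₁(e)`
and every `c` in the closed subtriple generated by `a`. -/
theorem subtriple_orthogonality
    {E : Type*} [NormedAddCommGroup E] [NormedSpace ℂ E] [CompleteSpace E]
    (tp : E → E → E → E)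
    (tp_add_left : ∀ x y a b : E, tp (x + y) a b = tp x a b + tp y a b)
    (tp_smul_left : ∀ (c : ℂ) (x a b : E), tp (c • x) a b = c • tp x a b)
    (tp_add_mid : ∀ a x y b : E, tp a (x + y) b = tp a x b + tp a y b)
    (tp_smul_mid : ∀ (c : ℂ) (a x b : E), tp a (c • x) b = (starRingEnd ℂ) c • tp a x b)
    (tp_comm : ∀ x y z : E, tp x y z = tp z y x)
    (tp_jordan : ∀ a b x y z : E, tp a b (tp x y z)
      = tp (tp a b x) y z - tp x (tp b a y) z + tp x y (tp a b z))
    (tp_cont : Continuous fun p : E × E × E => tp p.1 p.2.1 p.2.2)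
    (e : E) (he : tp e e e = e)
    (a : E) (ha : tp e e a = (1/2 : ℂ) • a) (haa : tp a a e = 0)
    (hab : ∀ b : E, tp e e b = (1/2 : ℂ) • b → tp a b e = 0) :
    ∀ c ∈ closedGenSubtriple tp a, ∀ b : E, tp e e b = (1/2 : ℂ) • b →
      tp c b e = 0 := by
  have add_right : ∀ x y z w : E, tp x y (z + w) = tp x y z + tp x y w := fun x y z w => by
    rw [tp_comm, tp_add_left, tp_comm z, tp_comm w]
  have smul_right : ∀ (k : ℂ) (x y z : E), tp x y (k • z) = k • tp x y z := fun k x y z => by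
    rw [tp_comm, tp_smul_left, tp_comm z]
  have zero_left : ∀ x y : E, tp 0 x y = 0 := fun x y => by
    simpa using tp_smul_left 0 0 x y
  have zero_right : ∀ x y : E, tp x y 0 = 0 := fun x y => by rw [tp_comm, zero_left]
  have conj_half : (starRingEnd ℂ) (1 / 2 : ℂ) = 1 / 2 := by simp [Complex.conj_ofNat]
  have peirce_one : ∀ x y z : E, tp e e x = (1 / 2 : ℂ) • x → tp e e y = (1 / 2 : ℂ) • y →
      tp e e z = (1 / 2 : ℂ) • z → tp e e (tp x y z) = (1 / 2 : ℂ) • tp x y z := by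
    intro x y z hx hy hz
    rw [tp_jordan, hx, hy, hz, tp_smul_left, tp_smul_mid, smul_right, conj_half]
    abel
  let V : Submodule ℂ E :=
    { carrier := {c | tp e e c = (1 / 2 : ℂ) • c ∧
        ∀ b : E, tp e e b = (1 / 2 : ℂ) • b → tp c b e = 0}
      add_mem' := by
        rintro x y ⟨hx, hx'⟩ ⟨hy, hy'⟩
        refine ⟨by rw [add_right, hx, hy, smul_add], fun b hb => ?_⟩
        rw [tp_add_left, hx' b hb, hy' b hb, add_zero]
      zero_mem' := ⟨by rw [zero_right, smul_zero], fun b _ => zero_left b e⟩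
      smul_mem' := by
        rintro k x ⟨hx, hx'⟩
        refine ⟨by rw [smul_right, hx, smul_comm], fun b hb => ?_⟩
        rw [tp_smul_left, hx' b hb, smul_zero] }
  have V_closed : IsClosed (V : Set E) := by
    have h₁ : IsClosed {c : E | tp e e c = (1 / 2 : ℂ) • c} :=
      isClosed_eq (tp_cont.comp (by fun_prop : Continuous fun c : E => (e, e, c)))
        (continuous_const_smul _)
    have h₂ : IsClosed {c : E | ∀ b : E, tp e e b = (1 / 2 : ℂ) • b → tp c b e = 0} := by
      simp only [Set.ofPred_forall]
      exact isClosed_iInter fun b => isClosed_iInter fun _ =>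
        isClosed_eq (tp_cont.comp (by fun_prop : Continuous fun c : E => (c, b, e)))
          continuous_const
    exact h₁.inter h₂
  have V_triple : ∀ x ∈ V, ∀ y ∈ V, ∀ z ∈ V, tp x y z ∈ V := by
    rintro x ⟨hx, hx'⟩ y ⟨hy, _⟩ z ⟨hz, hz'⟩
    refine ⟨peirce_one x y z hx hy hz, fun b hb => ?_⟩
    have h := tp_jordan x y z b e
    rw [hz' b hb, hz' _ (peirce_one y x b hy hx hb), hx' y hy, zero_right, zero_right,
      sub_zero, add_zero] at h
    exact h.symm
  intro c hc
  exact (Set.mem_iInter₂.mp hc V ⟨⟨ha, hab⟩, V_closed, V_triple⟩).2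
end

section
/- Assume hypotheses (P) and (S) hold for the tripotent e. Let a be an element of the Peirce-1 subspace E₁(e) with {a,a,e} = 0. Then {b,c,e} = 0 and Q(b)Q(c)(e) = 0 for every b, c in the closed subtriple E_a of E generated by a. In particular, {a^[3], e, a^[3]} = 0. -/
/-- The algebraic axioms of a complex Jordan triple product. -/
structure IsJordanTriple {E : Type*} [AddCommGroup E] [Module ℂ E] (tp : E → E → E → E) :
    Prop where
  add_left : ∀ x y a b : E, tp (x + y) a b = tp x a b + tp y a b
  smul_left : ∀ (c : ℂ) (x a b : E), tp (c • x) a b = c • tp x a b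
  add_mid : ∀ a x y b : E, tp a (x + y) b = tp a x b + tp a y b
  smul_mid : ∀ (c : ℂ) (a x b : E), tp a (c • x) b = (starRingEnd ℂ) c • tp a x b
  comm : ∀ x y z : E, tp x y z = tp z y x
  jordan : ∀ a b x y z : E, tp a b (tp x y z)
    = tp (tp a b x) y z - tp x (tp b a y) z + tp x y (tp a b z)

namespace IsJordanTriple

section Algebra

variable {E : Type*} [AddCommGroup E] [Module ℂ E] {tp : E → E → E → E}

theorem add_right (h : IsJordanTriple tp) (a b x y : E) :
    tp a b (x + y) = tp a b x + tp a b y := by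
  rw [h.comm, h.add_left, h.comm x, h.comm y]

theorem smul_right (h : IsJordanTriple tp) (c : ℂ) (a b x : E) :
    tp a b (c • x) = c • tp a b x := by
  rw [h.comm, h.smul_left, h.comm x]

theorem zero_left (h : IsJordanTriple tp) (a b : E) : tp 0 a b = 0 := by
  simpa using h.smul_left 0 0 a b

theorem zero_mid (h : IsJordanTriple tp) (a b : E) : tp a 0 b = 0 := by
  simpa using h.smul_mid 0 a 0 b

theorem zero_right (h : IsJordanTriple tp) (a b : E) : tp a b 0 = 0 := by
  rw [h.comm, h.zero_left]

/-- The Peirce-1 subspace of a tripotent is a subtriple. -/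
theorem tp_mem_peirceOne (h : IsJordanTriple tp) {e x y z : E}
    (hx : tp e e x = (1 / 2 : ℂ) • x) (hy : tp e e y = (1 / 2 : ℂ) • y)
    (hz : tp e e z = (1 / 2 : ℂ) • z) : tp e e (tp x y z) = (1 / 2 : ℂ) • tp x y z := by
  rw [h.jordan, hx, hy, hz, h.smul_left, h.smul_mid, h.smul_right]
  simp [Complex.conj_ofNat]

/-- If `x, y ∈ E₁(e)` then `{x, y, e} ∈ E₂(e)`. -/
theorem tp_mem_peirceTwo (h : IsJordanTriple tp) {e x y : E} (he : tp e e e = e)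
    (hx : tp e e x = (1 / 2 : ℂ) • x) (hy : tp e e y = (1 / 2 : ℂ) • y) :
    tp e e (tp x y e) = tp x y e := by
  rw [h.jordan, hx, hy, he, h.smul_left, h.smul_mid]
  simp [Complex.conj_ofNat]

/-- The elements of `E₁(e)` annihilated by the forms `{·, ·, e}` on `E₁(e)`. -/
def peirceOneRadical (h : IsJordanTriple tp) (e : E) : Submodule ℂ E where
  carrier := {b | tp e e b = (1 / 2 : ℂ) • b ∧
    ∀ w, tp e e w = (1 / 2 : ℂ) • w → tp b w e = 0 ∧ tp w b e = 0}
  zero_mem' := ⟨by simp [h.zero_right], fun w _ => ⟨h.zero_left w e, h.zero_mid w e⟩⟩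
  add_mem' := by
    rintro x y ⟨hx, hx'⟩ ⟨hy, hy'⟩
    refine ⟨by rw [h.add_right, hx, hy, smul_add], fun w hw => ?_⟩
    rw [h.add_left, h.add_mid, (hx' w hw).1, (hx' w hw).2, (hy' w hw).1, (hy' w hw).2]
    simp
  smul_mem' := by
    rintro c x ⟨hx, hx'⟩
    refine ⟨by rw [h.smul_right, hx, smul_comm], fun w hw => ?_⟩
    rw [h.smul_left, h.smul_mid, (hx' w hw).1, (hx' w hw).2]
    simp

theorem tp_mem_peirceOneRadical (h : IsJordanTriple tp) {e x y z : E}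
    (hx : x ∈ h.peirceOneRadical e) (hy : y ∈ h.peirceOneRadical e)
    (hz : z ∈ h.peirceOneRadical e) : tp x y z ∈ h.peirceOneRadical e := by
  refine ⟨h.tp_mem_peirceOne hx.1 hy.1 hz.1, fun w hw => ⟨?_, ?_⟩⟩
  · have key := h.jordan x y z w e
    rw [(hz.2 w hw).1, (hx.2 y hy.1).1, (hz.2 _ (h.tp_mem_peirceOne hy.1 hx.1 hw)).1,
      h.zero_right, h.zero_right] at key
    simpa using key.symm
  · have key := h.jordan y x w z e
    rw [(hz.2 w hw).2, (hy.2 x hx.1).1, (hz.2 _ (h.tp_mem_peirceOne hy.1 hx.1 hw)).2,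
      h.zero_right, h.zero_right] at key
    simpa using key.symm

theorem Q_Q_eq_zero_of_mem_peirceOneRadical (h : IsJordanTriple tp) {e b c : E}
    (hb : b ∈ h.peirceOneRadical e) (hc : c ∈ h.peirceOneRadical e) :
    tp b (tp c e c) b = 0 := by
  have hecb : tp e c b = 0 := by rw [h.comm, (hb.2 c hc.1).1]
  have hecbcb : tp e c (tp b c b) = 0 := by
    rw [h.comm, ((h.tp_mem_peirceOneRadical hb hc hb).2 c hc.1).1]
  have key := h.jordan e c b c b
  rw [hecbcb, hecb, h.zero_left, h.zero_right] at key
  simpa using key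

theorem tp_cube_cube_eq_zero (h : IsJordanTriple tp) {e a : E}
    (ha : a ∈ h.peirceOneRadical e) : tp (tp a a a) e (tp a a a) = 0 := by
  have hcube := h.tp_mem_peirceOneRadical ha ha ha
  have haae : tp a a e = 0 := (ha.2 a ha.1).1
  have heaa : tp e a a = 0 := by rw [h.comm, haae]
  have hace : tp a (tp a a a) e = 0 := (hcube.2 a ha.1).2
  have heac : tp e a (tp a a a) = 0 := by rw [h.comm, (hcube.2 a ha.1).1]
  have hca : tp (tp a a a) a a = tp a a (tp a a a) := h.comm _ _ _
  -- `{a, e, a^[3]} = 0`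
  have hu : tp a e (tp a a a) = 0 := by
    have h₁ := h.jordan a e a a a
    have h₂ := h.jordan a a a e a
    rw [heaa, h.zero_mid, h.comm (tp a e a) a a] at h₁
    rw [haae, h.zero_mid, h.comm (tp a a a) e a] at h₂
    rw [h₂] at h₁
    have h₃ : (3 : ℂ) • tp a e (tp a a a) = 0 := by
      linear_combination (norm := module) (-1 : ℂ) • h₁
    simpa using h₃
  -- `{a, e, {a, a, a^[3]}} = 0`
  have hv : tp a e (tp a a (tp a a a)) = 0 := by
    have h₁ := h.jordan a e a a (tp a a a)
    have h₂ := h.jordan (tp a a a) a a e a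
    rw [heaa, h.zero_mid, hu, h.zero_right, h.comm (tp a e a)] at h₁
    rw [hca, hace, h.zero_mid, h.comm (tp a a (tp a a a)) e a] at h₂
    rw [h₂] at h₁
    simpa using h₁
  have key := h.jordan a a a e (tp a a a)
  rw [hu, h.zero_right, haae, h.zero_mid, hv] at key
  simpa using key.symm

end Algebra

theorem isClosed_peirceOneRadical {E : Type*} [NormedAddCommGroup E] [NormedSpace ℂ E]
    {tp : E → E → E → E} (h : IsJordanTriple tp)
    (hc : Continuous fun p : E × E × E => tp p.1 p.2.1 p.2.2) (e : E) :
    IsClosed (h.peirceOneRadical e : Set E) := by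
  have hl (y z : E) : Continuous fun x => tp x y z :=
    hc.comp (by fun_prop : Continuous fun x : E => (x, y, z))
  have hm (x z : E) : Continuous fun y => tp x y z :=
    hc.comp (by fun_prop : Continuous fun y : E => (x, y, z))
  have hr (x y : E) : Continuous fun z => tp x y z :=
    hc.comp (by fun_prop : Continuous fun z : E => (x, y, z))
  have heq : (h.peirceOneRadical e : Set E) = {b | tp e e b = (1 / 2 : ℂ) • b} ∩
      ⋂ w ∈ {w | tp e e w = (1 / 2 : ℂ) • w}, {b | tp b w e = 0} ∩ {b | tp w b e = 0} := by
    ext b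
    simp [peirceOneRadical]
  rw [heq]
  exact (isClosed_eq (hr e e) (continuous_const_smul _)).inter <|
    isClosed_biInter fun w _ =>
      (isClosed_eq (hl w e) continuous_const).inter (isClosed_eq (hm w e) continuous_const)

end IsJordanTriple

theorem Complex.eq_zero_of_forall_nonneg_add_mul {r w : ℂ}
    (h : ∀ t : ℝ, ∃ s : ℝ, 0 ≤ s ∧ r + t * w = s) : w = 0 := by
  obtain ⟨s₀, hs₀, h₀⟩ := h 0
  have hr : r = s₀ := by simpa using h₀
  have him : w.im = 0 := by
    obtain ⟨s, -, hs⟩ := h 1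
    simpa [hr] using congrArg Complex.im hs
  have hre : ∀ t : ℝ, 0 ≤ s₀ + t * w.re := by
    intro t
    obtain ⟨s, hs0, hs⟩ := h t
    have := congrArg Complex.re hs
    simp [hr] at this
    linarith
  refine Complex.ext ?_ him
  by_contra hne
  have := hre (-(s₀ + 1) / w.re)
  rw [div_mul_cancel₀ _ hne] at this
  linarith

/-- An isotropic vector of the positive semidefinite form `φ {·, ·, e}` lies in its radical. -/
theorem IsJordanTriple.form_eq_zero {E : Type*} [NormedAddCommGroup E] [NormedSpace ℂ E]
    {tp : E → E → E → E} (h : IsJordanTriple tp) {e a : E} (haa : tp a a e = 0)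
    {φ : E →L[ℂ] ℂ} (hφ : ∀ x, ∃ r : ℝ, 0 ≤ r ∧ φ (tp x x e) = r) (y : E) :
    φ (tp a y e) = 0 ∧ φ (tp y a e) = 0 := by
  have expand (t : ℂ) : φ (tp (y + t • a) (y + t • a) e) =
      φ (tp y y e) + (t * φ (tp a y e) + (starRingEnd ℂ) t * φ (tp y a e)) := by
    simp only [h.add_left, h.add_mid, h.smul_left, h.smul_mid, haa, map_add, map_smul,
      smul_eq_mul, map_zero]
    ring
  have hsum : φ (tp a y e) + φ (tp y a e) = 0 := by
    refine Complex.eq_zero_of_forall_nonneg_add_mul (r := φ (tp y y e)) fun t => ?_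
    obtain ⟨s, hs, hs'⟩ := hφ (y + (t : ℂ) • a)
    refine ⟨s, hs, ?_⟩
    rw [← hs', expand, Complex.conj_ofReal]
    ring
  have hdiff : Complex.I * (φ (tp a y e) - φ (tp y a e)) = 0 := by
    refine Complex.eq_zero_of_forall_nonneg_add_mul (r := φ (tp y y e)) fun t => ?_
    obtain ⟨s, hs, hs'⟩ := hφ (y + ((t : ℂ) * Complex.I) • a)
    refine ⟨s, hs, ?_⟩
    rw [← hs', expand, map_mul, Complex.conj_ofReal, Complex.conj_I]
    ring
  have hdiff' := (mul_eq_zero.mp hdiff).resolve_left Complex.I_ne_zero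
  constructor
  · linear_combination (hsum + hdiff') / 2
  · linear_combination (hsum - hdiff') / 2

/-- Lemma `element in E1 and nilpotent`: under hypotheses (P) and (S)
for the tripotent `e`, if `a ∈ E₁(e)` and `{a,a,e} = 0`, then `{b,c,e} = 0` and
`Q(b)Q(c)(e) = 0` for every `b, c` in the closed subtriple generated by `a`.
In particular `{a^[3], e, a^[3]} = 0`. -/
theorem element_in_E1_and_nilpotent
    {E : Type*} [NormedAddCommGroup E] [NormedSpace ℂ E] [CompleteSpace E]
    (tp : E → E → E → E)
    (tp_add_left : ∀ x y a b : E, tp (x + y) a b = tp x a b + tp y a b)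
    (tp_smul_left : ∀ (c : ℂ) (x a b : E), tp (c • x) a b = c • tp x a b)
    (tp_add_mid : ∀ a x y b : E, tp a (x + y) b = tp a x b + tp a y b)
    (tp_smul_mid : ∀ (c : ℂ) (a x b : E), tp a (c • x) b = (starRingEnd ℂ) c • tp a x b)
    (tp_comm : ∀ x y z : E, tp x y z = tp z y x)
    (tp_jordan : ∀ a b x y z : E, tp a b (tp x y z)
      = tp (tp a b x) y z - tp x (tp b a y) z + tp x y (tp a b z))
    (tp_cont : Continuous fun p : E × E × E => tp p.1 p.2.1 p.2.2)
    (e : E) (he : tp e e e = e)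
    (hP : ∀ (x : E) (φ : E →L[ℂ] ℂ), ‖φ‖ = 1 → φ e = 1 →
      ∃ r : ℝ, 0 ≤ r ∧ φ (tp x x e) = (r : ℂ))
    (hS : ∀ z : E, tp e e z = z →
      (∀ φ : E →L[ℂ] ℂ, ‖φ‖ = 1 → φ e = 1 → φ z = 0) → z = 0)
    (a : E) (ha : tp e e a = (1/2 : ℂ) • a) (haa : tp a a e = 0) :
    (∀ b ∈ closedGenSubtriple tp a, ∀ c ∈ closedGenSubtriple tp a,
        tp b c e = 0 ∧ tp b (tp c e c) b = 0) ∧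
      tp (tp a a a) e (tp a a a) = 0 := by
  have h : IsJordanTriple tp :=
    ⟨tp_add_left, tp_smul_left, tp_add_mid, tp_smul_mid, tp_comm, tp_jordan⟩
  have hmem : a ∈ h.peirceOneRadical e := by
    refine ⟨ha, fun w hw => ⟨?_, ?_⟩⟩
    · exact hS _ (h.tp_mem_peirceTwo he ha hw) fun φ hφ hφe =>
        (h.form_eq_zero haa (fun x => hP x φ hφ hφe) w).1
    · exact hS _ (h.tp_mem_peirceTwo he hw ha) fun φ hφ hφe =>
        (h.form_eq_zero haa (fun x => hP x φ hφ hφe) w).2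
  have hsub : closedGenSubtriple tp a ⊆ h.peirceOneRadical e :=
    Set.biInter_subset_of_mem ⟨hmem, h.isClosed_peirceOneRadical tp_cont e,
      fun _ hx _ hy _ hz => h.tp_mem_peirceOneRadical hx hy hz⟩
  refine ⟨fun b hb c hc => ⟨?_, ?_⟩, h.tp_cube_cube_eq_zero hmem⟩
  · exact ((hsub hb).2 c (hsub hc).1).1
  · exact h.Q_Q_eq_zero_of_mem_peirceOneRadical (hsub hb) (hsub hc)
end

section
/- Assume hypotheses (P) and (S) hold for the tripotent e. Let a ∈ E₁(e) with {a,a,e} = 0. Then {b,c,e} = 0 whenever b and c belong to E₁(e) and at least one of them lies in the closed subtriple E_a of E generated by a. -/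
/-- A complex affine function of a real variable that takes only nonnegative real values is
constant. -/
theorem eq_zero_of_forall_ofReal_mul_add_nonneg {w d : ℂ}
    (h : ∀ s : ℝ, ∃ q : ℝ, 0 ≤ q ∧ s * w + d = (q : ℂ)) : w = 0 := by
  have him : ∀ s : ℝ, s * w.im + d.im = 0 := fun s => by
    obtain ⟨q, -, hq⟩ := h s
    simpa using congrArg Complex.im hq
  have hre : ∀ s : ℝ, 0 ≤ s * w.re + d.re := fun s => by
    obtain ⟨q, hq0, hq⟩ := h s
    have := congrArg Complex.re hq
    simp only [Complex.add_re, Complex.re_ofReal_mul, Complex.ofReal_re] at this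
    linarith
  refine Complex.ext ?_ ?_
  · by_contra hw
    have hw' : w.re ≠ 0 := hw
    have := hre (-(d.re + 1) / w.re)
    rw [div_mul_cancel₀ _ hw'] at this
    linarith
  · have h0 := him 0
    have h1 := him 1
    simp only [Complex.zero_im]
    linarith

/-- Cauchy-Schwarz at a null vector: if `t * u + conj t * v + d` is a nonnegative real for all
complex `t`, then `u = v = 0`. -/
theorem eq_zero_and_eq_zero_of_forall_mul_add_conj_mul_add_nonneg {u v d : ℂ}
    (h : ∀ t : ℂ, ∃ q : ℝ, 0 ≤ q ∧ t * u + (starRingEnd ℂ) t * v + d = (q : ℂ)) :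
    u = 0 ∧ v = 0 := by
  have h₁ : u + v = 0 := eq_zero_of_forall_ofReal_mul_add_nonneg (d := d) fun s => by
    obtain ⟨q, hq0, hq⟩ := h s
    refine ⟨q, hq0, ?_⟩
    rw [← hq, Complex.conj_ofReal]
    ring
  have h₂ : Complex.I * (u - v) = 0 := eq_zero_of_forall_ofReal_mul_add_nonneg (d := d) fun s => by
    obtain ⟨q, hq0, hq⟩ := h (s * Complex.I)
    refine ⟨q, hq0, ?_⟩
    rw [← hq, map_mul, Complex.conj_ofReal, Complex.conj_I]
    ring
  have h₃ : u - v = 0 := (mul_eq_zero.mp h₂).resolve_left Complex.I_ne_zero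
  exact ⟨by linear_combination (h₁ + h₃) / 2, by linear_combination (h₁ - h₃) / 2⟩

/-- Remark 1: under hypotheses (P) and (S) for the tripotent `e`,
if `a ∈ E₁(e)` and `{a,a,e} = 0`, then `{b,c,e} = 0` whenever `b, c ∈ E₁(e)` and
at least one of them lies in the closed subtriple generated by `a`. -/
theorem remark_orthogonality
    {E : Type*} [NormedAddCommGroup E] [NormedSpace ℂ E] [CompleteSpace E]
    (tp : E → E → E → E)
    (tp_add_left : ∀ x y a b : E, tp (x + y) a b = tp x a b + tp y a b)
    (tp_smul_left : ∀ (c : ℂ) (x a b : E), tp (c • x) a b = c • tp x a b)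
    (tp_add_mid : ∀ a x y b : E, tp a (x + y) b = tp a x b + tp a y b)
    (tp_smul_mid : ∀ (c : ℂ) (a x b : E), tp a (c • x) b = (starRingEnd ℂ) c • tp a x b)
    (tp_comm : ∀ x y z : E, tp x y z = tp z y x)
    (tp_jordan : ∀ a b x y z : E, tp a b (tp x y z)
      = tp (tp a b x) y z - tp x (tp b a y) z + tp x y (tp a b z))
    (tp_cont : Continuous fun p : E × E × E => tp p.1 p.2.1 p.2.2)
    (e : E) (he : tp e e e = e)
    (hP : ∀ (x : E) (φ : E →L[ℂ] ℂ), ‖φ‖ = 1 → φ e = 1 →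
      ∃ r : ℝ, 0 ≤ r ∧ φ (tp x x e) = (r : ℂ))
    (hS : ∀ z : E, tp e e z = z →
      (∀ φ : E →L[ℂ] ℂ, ‖φ‖ = 1 → φ e = 1 → φ z = 0) → z = 0)
    (a : E) (ha : tp e e a = (1/2 : ℂ) • a) (haa : tp a a e = 0) :
    ∀ b c : E, tp e e b = (1/2 : ℂ) • b → tp e e c = (1/2 : ℂ) • c →
      (b ∈ closedGenSubtriple tp a ∨ c ∈ closedGenSubtriple tp a) →
      tp b c e = 0 := by
  have conj_half : (starRingEnd ℂ) (1 / 2 : ℂ) = 1 / 2 := by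
    rw [map_div₀, map_one, Complex.conj_ofNat]
  have smul_right : ∀ (t : ℂ) (x y z : E), tp x y (t • z) = t • tp x y z := fun t x y z => by
    rw [tp_comm, tp_smul_left, tp_comm]
  have add_right : ∀ x y z w : E, tp x y (z + w) = tp x y z + tp x y w := fun x y z w => by
    rw [tp_comm, tp_add_left, tp_comm z, tp_comm w]
  have zero_left : ∀ x y : E, tp 0 x y = 0 := fun x y => by
    simpa using tp_smul_left 0 0 x y
  have zero_mid : ∀ x y : E, tp x 0 y = 0 := fun x y => by
    simpa using tp_smul_mid 0 x 0 y
  have zero_right : ∀ x y : E, tp x y 0 = 0 := fun x y => by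
    rw [tp_comm, zero_left]
  have peirce_two : ∀ x y : E, tp e e x = (1 / 2 : ℂ) • x → tp e e y = (1 / 2 : ℂ) • y →
      tp e e (tp x y e) = tp x y e := fun x y hx hy => by
    rw [tp_jordan, hx, hy, he, tp_smul_left, tp_smul_mid, conj_half]
    module
  have peirce_one : ∀ x y z : E, tp e e x = (1 / 2 : ℂ) • x → tp e e y = (1 / 2 : ℂ) • y →
      tp e e z = (1 / 2 : ℂ) • z → tp e e (tp x y z) = (1 / 2 : ℂ) • tp x y z :=
    fun x y z hx hy hz => by
      rw [tp_jordan, hx, hy, hz, tp_smul_left, tp_smul_mid, smul_right, conj_half]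
      module
  have state_zero : ∀ (c : E) (φ : E →L[ℂ] ℂ), ‖φ‖ = 1 → φ e = 1 →
      φ (tp a c e) = 0 ∧ φ (tp c a e) = 0 := fun c φ hφ hφe => by
    refine eq_zero_and_eq_zero_of_forall_mul_add_conj_mul_add_nonneg
      (d := φ (tp c c e)) fun t => ?_
    obtain ⟨q, hq0, hq⟩ := hP (t • a + c) φ hφ hφe
    refine ⟨q, hq0, ?_⟩
    rw [← hq]
    simp only [tp_add_left, tp_add_mid, tp_smul_left, tp_smul_mid, haa, map_add, map_smul,
      smul_eq_mul, map_zero, mul_zero]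
    ring
  have cont : ∀ {f g h : E → E}, Continuous f → Continuous g → Continuous h →
      Continuous fun x => tp (f x) (g x) (h x) := fun hf hg hh =>
    tp_cont.comp (hf.prodMk (hg.prodMk hh))
  let N : Submodule ℂ E :=
    { carrier := {x | tp e e x = (1 / 2 : ℂ) • x ∧
        ∀ c, tp e e c = (1 / 2 : ℂ) • c → tp x c e = 0 ∧ tp c x e = 0}
      zero_mem' := by simp [zero_left, zero_mid, zero_right]
      add_mem' := by
        rintro x y ⟨hx, hx'⟩ ⟨hy, hy'⟩
        refine ⟨by rw [add_right, hx, hy, smul_add], fun c hc => ⟨?_, ?_⟩⟩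
        · rw [tp_add_left, (hx' c hc).1, (hy' c hc).1, add_zero]
        · rw [tp_add_mid, (hx' c hc).2, (hy' c hc).2, add_zero]
      smul_mem' := by
        rintro t x ⟨hx, hx'⟩
        refine ⟨by rw [smul_right, hx, smul_comm], fun c hc => ⟨?_, ?_⟩⟩
        · rw [tp_smul_left, (hx' c hc).1, smul_zero]
        · rw [tp_smul_mid, (hx' c hc).2, smul_zero] }
  have a_mem : a ∈ N :=
    ⟨ha, fun c hc =>
      ⟨hS _ (peirce_two a c ha hc) fun φ hφ hφe => (state_zero c φ hφ hφe).1,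
        hS _ (peirce_two c a hc ha) fun φ hφ hφe => (state_zero c φ hφ hφe).2⟩⟩
  have N_closed : IsClosed (N : Set E) := by
    change IsClosed {x | tp e e x = (1 / 2 : ℂ) • x ∧
      ∀ c, tp e e c = (1 / 2 : ℂ) • c → tp x c e = 0 ∧ tp c x e = 0}
    simp only [Set.ofPred_and, Set.ofPred_forall]
    refine (isClosed_eq (cont continuous_const continuous_const continuous_id)
      (continuous_const_smul _)).inter
      (isClosed_iInter fun c => isClosed_iInter fun _ => IsClosed.inter ?_ ?_)
    · exact isClosed_eq (cont continuous_id continuous_const continuous_const) continuous_const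
    · exact isClosed_eq (cont continuous_const continuous_id continuous_const) continuous_const
  have N_tp : ∀ x ∈ N, ∀ y ∈ N, ∀ z ∈ N, tp x y z ∈ N := by
    rintro x ⟨hx, hx'⟩ y ⟨hy, hy'⟩ z ⟨hz, hz'⟩
    refine ⟨peirce_one x y z hx hy hz, fun c hc => ⟨?_, ?_⟩⟩
    · have h := tp_jordan x y z c e
      rw [(hz' c hc).1, (hz' _ (peirce_one y x c hy hx hc)).1, (hx' y hy).1, zero_right,
        zero_right, sub_zero, add_zero] at h
      exact h.symm
    · have h := tp_jordan y x c z e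
      rw [(hz' c hc).2, (hz' _ (peirce_one y x c hy hx hc)).2, (hy' x hx).1, zero_right,
        zero_right, zero_sub, add_zero] at h
      exact neg_eq_zero.mp h.symm
  have sub : closedGenSubtriple tp a ⊆ (N : Set E) := Set.biInter_subset_of_mem ⟨a_mem, N_closed, N_tp⟩
  rintro b c hb hc (h | h)
  · exact ((sub h).2 c hc).1
  · exact ((sub h).2 b hb).2
end

section
/- Assume hypotheses (P) and (S) hold for the tripotent e, and assume in addition that ‖{x,x,x}‖ = ‖x‖³ for every x ∈ E. Then the sesquilinear map F₁(a,b) := {a,b,e} on E₁(e) × E₁(e) is positive definite: for every a ∈ E₁(e), {a,a,e} = 0 implies a = 0 (equivalently, for a ∈ E₁(e), {a,a,e} = 0 if and only if a = 0). -/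
/-- If `k + t u + conj t v` is a nonnegative real number for every complex `t`, then `v = 0`. -/
theorem eq_zero_of_forall_nonneg_add_smul (k u v : ℂ)
    (h : ∀ t : ℂ, ∃ r : ℝ, 0 ≤ r ∧ k + t * u + (starRingEnd ℂ) t * v = (r : ℂ)) : v = 0 := by
  have affine : ∀ k m : ℝ, (∀ s : ℝ, 0 ≤ k + s * m) → m = 0 := by
    intro k m hk
    by_contra hm
    have := hk (-(k + 1) / m)
    rw [div_mul_cancel₀ _ hm] at this
    linarith
  have hre : ∀ t : ℂ, 0 ≤ (k + t * u + (starRingEnd ℂ) t * v).re := by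
    intro t
    obtain ⟨r, hr, ht⟩ := h t
    rw [ht]
    simpa using hr
  have him : ∀ t : ℂ, (k + t * u + (starRingEnd ℂ) t * v).im = 0 := by
    intro t
    obtain ⟨r, -, ht⟩ := h t
    rw [ht]
    simp
  have hre_sum : u.re + v.re = 0 := by
    refine affine k.re _ fun s => ?_
    have := hre (s : ℂ)
    simp at this
    linarith
  have hre_diff : v.im - u.im = 0 := by
    refine affine k.re _ fun s => ?_
    have := hre (s * Complex.I)
    simp at this
    linarith
  have h0 := him 0
  have h1 := him 1
  have hI := him Complex.I
  simp at h0 h1 hI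
  apply Complex.ext
  · simp
    linarith
  · simp
    linarith


/-- Lemma `l positivity`: under hypotheses (P) and (S) for the
tripotent `e`, and the axiom `‖{x,x,x}‖ = ‖x‖³`, the sesquilinear map
`F₁(a,b) = {a,b,e}` is positive definite on `E₁(e)`: for `a ∈ E₁(e)`,
`{a,a,e} = 0` if and only if `a = 0`. -/
theorem F_one_positive_definite
    {E : Type*} [NormedAddCommGroup E] [NormedSpace ℂ E] [CompleteSpace E]
    (tp : E → E → E → E)
    (tp_add_left : ∀ x y a b : E, tp (x + y) a b = tp x a b + tp y a b)
    (tp_smul_left : ∀ (c : ℂ) (x a b : E), tp (c • x) a b = c • tp x a b)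
    (tp_add_mid : ∀ a x y b : E, tp a (x + y) b = tp a x b + tp a y b)
    (tp_smul_mid : ∀ (c : ℂ) (a x b : E), tp a (c • x) b = (starRingEnd ℂ) c • tp a x b)
    (tp_comm : ∀ x y z : E, tp x y z = tp z y x)
    (tp_jordan : ∀ a b x y z : E, tp a b (tp x y z)
      = tp (tp a b x) y z - tp x (tp b a y) z + tp x y (tp a b z))
    (tp_cont : Continuous fun p : E × E × E => tp p.1 p.2.1 p.2.2)
    (tp_norm : ∀ x : E, ‖tp x x x‖ = ‖x‖ ^ 3)
    (e : E) (he : tp e e e = e)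
    (hP : ∀ (x : E) (φ : E →L[ℂ] ℂ), ‖φ‖ = 1 → φ e = 1 →
      ∃ r : ℝ, 0 ≤ r ∧ φ (tp x x e) = (r : ℂ))
    (hS : ∀ z : E, tp e e z = z →
      (∀ φ : E →L[ℂ] ℂ, ‖φ‖ = 1 → φ e = 1 → φ z = 0) → z = 0) :
    ∀ a : E, tp e e a = (1/2 : ℂ) • a → (tp a a e = 0 ↔ a = 0) := by
  intro a ha
  have smul_right : ∀ (c : ℂ) (x y z : E), tp x y (c • z) = c • tp x y z := fun c x y z => by
    rw [tp_comm, tp_smul_left, tp_comm]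
  have zero_left : ∀ x y : E, tp 0 x y = 0 := fun x y => by
    simpa using tp_smul_left 0 0 x y
  have zero_right : ∀ x y : E, tp x y 0 = 0 := fun x y => by
    simpa using smul_right 0 x y 0
  have zero_mid : ∀ x y : E, tp x 0 y = 0 := fun x y => by
    simpa using tp_smul_mid 0 x 0 y
  have conj_half : (starRingEnd ℂ) (1 / 2 : ℂ) = 1 / 2 := by
    rw [Complex.conj_eq_iff_im]
    norm_num
  refine ⟨fun haa => ?_, fun h => by rw [h, zero_left]⟩
  have ha' : tp a e e = (1 / 2 : ℂ) • a := by rw [tp_comm, ha]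
  have heaa : tp e a a = 0 := by rw [tp_comm, haa]
  set b := tp a a a with hb
  set c := tp a e a with hc
  have hb1 : tp e e b = (1 / 2 : ℂ) • b := by
    rw [hb, tp_jordan, ha, tp_smul_left, tp_smul_mid, smul_right, conj_half]
    module
  have hbae : tp b a e = 0 := by
    apply hS
    · rw [tp_jordan, hb1, ha, he, tp_smul_left, tp_smul_mid, conj_half]
      module
    · intro φ hφ hφe
      apply eq_zero_of_forall_nonneg_add_smul (φ (tp b b e)) (φ (tp a b e))
      intro t
      obtain ⟨r, hr, hrt⟩ := hP (b + t • a) φ hφ hφe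
      refine ⟨r, hr, ?_⟩
      rw [← hrt]
      simp only [tp_add_left, tp_add_mid, tp_smul_left, tp_smul_mid, haa, map_add, map_smul,
        smul_eq_mul, map_zero, smul_zero]
      ring
  have hQc : tp a c a = 0 := by
    have h := tp_jordan e a a a a
    rw [← hb, ← hc, heaa, zero_left, zero_right, tp_comm, hbae] at h
    simpa using h.symm
  have hb2 : b = (-2 : ℂ) • tp c a e := by
    have h := tp_jordan e a a e a
    rw [← hc, heaa, zero_left, zero_right, ha', tp_smul_mid, conj_half, ← hb, tp_comm] at h
    rw [h]
    module
  have hQ : tp a (tp c a e) a = 0 := by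
    have h1 := tp_jordan a c a e a
    rw [hQc, ← hc, zero_left, zero_right] at h1
    have h2 := tp_jordan a e a c a
    rw [hQc, ← hc, zero_right, tp_comm e a c, tp_comm a c c] at h2
    rw [tp_comm a c c] at h1
    have h1' : tp a (tp c a e) a = -tp c c a := by
      rw [h1]; abel
    rw [h1'] at h2
    have h3 : (3 : ℂ) • tp c c a = 0 := by
      rw [h2]; module
    have h4 : tp c c a = 0 := by simpa using h3
    rw [h1', h4, neg_zero]
  have hfive : tp a b a = 0 := by
    rw [hb2, tp_smul_mid, hQ, smul_zero]
  have hfive' : tp b a a = 0 := by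
    have h := tp_jordan a a a a a
    rw [← hb, hfive, tp_comm a a b] at h
    have h' : tp b a a = tp b a a + tp b a a := by simpa using h
    simpa using h'
  have hseven : tp b b a = 0 := by
    have h := tp_jordan a b a a a
    rw [← hb, hfive, hfive', zero_left, zero_mid, zero_right, tp_comm] at h
    simpa using h
  have hnine : tp b b b = 0 := by
    have h := tp_jordan b b a a a
    rw [← hb, hseven, zero_left, zero_mid, zero_right] at h
    simpa using h
  have hb0 : b = 0 := by
    have h := tp_norm b
    rw [hnine, norm_zero] at h
    exact norm_eq_zero.mp (pow_eq_zero_iff three_ne_zero |>.mp h.symm)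
  have h := tp_norm a
  rw [← hb, hb0, norm_zero] at h
  exact norm_eq_zero.mp (pow_eq_zero_iff three_ne_zero |>.mp h.symm)
end

section
/- Let ψ be a continuous linear functional on C₀(S,ℂ) with ‖ψ‖ = 1 and ψ(a) = 1, where a(t) = t. Then ψ(g) = g(1) for every g ∈ C₀(S,ℂ); that is, ψ is the evaluation functional at the point 1. -/
open ZeroAtInfty

/-- A functional of norm at most `1` that takes the value `1` at the function `t ↦ t` annihilates
every function vanishing at `1`. -/
theorem functional_eq_zero_of_apply_one_eq_zero
    {S : Set ℝ} (hS : S ⊆ Set.Ioc 0 1) (h1 : (1 : ℝ) ∈ S)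
    {a : C₀(S, ℂ)} (ha : ∀ t : S, a t = ((t : ℝ) : ℂ))
    {ψ : C₀(S, ℂ) →L[ℂ] ℂ} (hψ : ‖ψ‖ ≤ 1) (hψa : ψ a = 1)
    {g : C₀(S, ℂ)} (hg : g ⟨1, h1⟩ = 0) : ψ g = 0 := by
  refine norm_le_zero_iff.1 (le_of_forall_pos_le_add fun ε hε => ?_)
  rw [zero_add]
  obtain ⟨K, hK, hgK⟩ : ∃ K : ℝ, 0 < K ∧ ∀ t : S, ‖g t‖ ≤ ε + K * (1 - (t : ℝ)) := by
    obtain ⟨δ, hδ, hgδ⟩ := Metric.continuousAt_iff.1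
      ((map_continuous g).continuousAt (x := ⟨1, h1⟩)) ε hε
    refine ⟨(‖g‖ + 1) / δ, by positivity, fun t => ?_⟩
    have ht := hS t.2
    by_cases h : dist t ⟨1, h1⟩ < δ
    · have h' := hgδ h
      rw [hg, dist_zero_right] at h'
      have : 0 ≤ (‖g‖ + 1) / δ * (1 - (t : ℝ)) :=
        mul_nonneg (by positivity) (sub_nonneg.2 ht.2)
      linarith
    · rw [Subtype.dist_eq, Real.dist_eq, abs_sub_comm, abs_of_nonneg (sub_nonneg.2 ht.2),
        not_lt] at h
      have hgt : ‖g t‖ ≤ ‖g‖ := g.toBCF.norm_coe_le_norm t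
      have : ‖g‖ + 1 ≤ (‖g‖ + 1) / δ * (1 - (t : ℝ)) := by
        rw [div_mul_eq_mul_div, le_div_iff₀ hδ]
        gcongr
      linarith
  obtain ⟨c, hc, hcψ⟩ : ∃ c : ℂ, ‖c‖ = 1 ∧ c * ψ g = ‖ψ g‖ := by
    obtain ⟨c, hc, h⟩ := RCLike.exists_norm_eq_mul_self (ψ g)
    exact ⟨c, hc, h.symm⟩
  have hnorm : ‖a + ((K⁻¹ : ℝ) : ℂ) • c • g‖ ≤ 1 + K⁻¹ * ε := by
    rw [← ZeroAtInftyContinuousMap.norm_toBCF_eq_norm]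
    refine (BoundedContinuousFunction.norm_le (by positivity)).2 fun t => ?_
    have ht := hS t.2
    calc ‖a t + ((K⁻¹ : ℝ) : ℂ) * (c * g t)‖
        ≤ ‖a t‖ + ‖((K⁻¹ : ℝ) : ℂ) * (c * g t)‖ := norm_add_le _ _
      _ = t + K⁻¹ * ‖g t‖ := by
        rw [ha, norm_mul, norm_mul, hc, one_mul, Complex.norm_of_nonneg ht.1.le,
          Complex.norm_of_nonneg (by positivity)]
      _ ≤ t + K⁻¹ * (ε + K * (1 - (t : ℝ))) := by gcongr; exact hgK t
      _ = 1 + K⁻¹ * ε := by field_simp; ring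
  have hle : ‖ψ (a + ((K⁻¹ : ℝ) : ℂ) • c • g)‖ ≤ 1 + K⁻¹ * ε :=
    (ψ.le_of_opNorm_le hψ _).trans (by rwa [one_mul])
  have heq : ψ (a + ((K⁻¹ : ℝ) : ℂ) • c • g) = ((1 + K⁻¹ * ‖ψ g‖ : ℝ) : ℂ) := by
    rw [map_add, map_smul, map_smul, hψa, smul_eq_mul, smul_eq_mul, hcψ]
    push_cast
    rfl
  rw [heq, Complex.norm_of_nonneg (by positivity)] at hle
  exact le_of_mul_le_mul_left (by linarith) (inv_pos.2 hK)

/-- if `S ⊆ (0,1]` with `1 ∈ S` and `S ∪ {0}` compact, `a ∈ C₀(S,ℂ)`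
is the function `t ↦ t`, and `ψ` is a continuous linear functional on `C₀(S,ℂ)`
with `‖ψ‖ = 1` and `ψ(a) = 1`, then `ψ` is the evaluation functional at `1`. -/
theorem functional_is_evaluation_at_one
    (S : Set ℝ) (hS : S ⊆ Set.Ioc 0 1) (h1 : (1 : ℝ) ∈ S)
    (hcomp : IsCompact (S ∪ {0}))
    (a : C₀(S, ℂ)) (ha : ∀ t : S, a t = ((t : ℝ) : ℂ))
    (ψ : C₀(S, ℂ) →L[ℂ] ℂ) (hψ : ‖ψ‖ = 1) (hψa : ψ a = 1) :
    ∀ g : C₀(S, ℂ), ψ g = g ⟨1, h1⟩ := by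
  intro g
  have h := functional_eq_zero_of_apply_one_eq_zero hS h1 ha hψ.le hψa
    (g := g - g ⟨1, h1⟩ • a) (by simp [ha])
  rwa [map_sub, map_smul, hψa, smul_eq_mul, mul_one, sub_eq_zero] at h
end

section
/- Let ψ be a continuous linear functional on C₀(S,ℂ) with ‖ψ‖ = 1 and ψ(a) = 1, where a(t) = t. Then ψ is a triple homomorphism for the natural triple product {f,g,h} := f·conj(g)·h of C₀(S,ℂ): for all f, g, h ∈ C₀(S,ℂ), ψ(f·conj(g)·h) = ψ(f)·conj(ψ(g))·ψ(h). -/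
open ZeroAtInfty

theorem ZeroAtInftyContinuousMap.norm_le_of_forall_norm_apply_le {X : Type*} [TopologicalSpace X]
    {f : C₀(X, ℂ)} {C : ℝ} (hC : 0 ≤ C) (h : ∀ x, ‖f x‖ ≤ C) : ‖f‖ ≤ C := by
  rw [← ZeroAtInftyContinuousMap.norm_toBCF_eq_norm]
  exact (BoundedContinuousFunction.norm_le hC).2 h

theorem ZeroAtInftyContinuousMap.norm_apply_le {X : Type*} [TopologicalSpace X]
    (f : C₀(X, ℂ)) (x : X) : ‖f x‖ ≤ ‖f‖ := by
  rw [← ZeroAtInftyContinuousMap.norm_toBCF_eq_norm]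
  exact f.toBCF.norm_coe_le_norm x

/-- A contractive functional taking the value `1` at the coordinate function has nonpositive real
part at functions vanishing at `1`, since `‖a + r • f‖ ≤ 1 + r * ε` for small `r > 0`. -/
theorem re_functional_nonpos_of_apply_one_eq_zero
    {S : Set ℝ} (hS : S ⊆ Set.Ioc 0 1) (h1 : (1 : ℝ) ∈ S)
    {a : C₀(S, ℂ)} (ha : ∀ t : S, a t = ((t : ℝ) : ℂ))
    {ψ : C₀(S, ℂ) →L[ℂ] ℂ} (hψ : ‖ψ‖ ≤ 1) (hψa : ψ a = 1)
    {f : C₀(S, ℂ)} (hf : f ⟨1, h1⟩ = 0) : (ψ f).re ≤ 0 := by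
  refine le_of_forall_pos_le_add fun ε hε => ?_
  obtain ⟨δ, hδ, hfδ⟩ := Metric.continuous_iff.1 (map_continuous f) ⟨1, h1⟩ ε hε
  have hr : 0 < δ / (‖f‖ + 1) := by positivity
  set r : ℝ := δ / (‖f‖ + 1) with hr_def
  have hrf : r * ‖f‖ ≤ δ := by
    have : r * (‖f‖ + 1) = δ := div_mul_cancel₀ _ (by positivity)
    linarith
  have hnorm : ‖a + (r : ℂ) • f‖ ≤ 1 + r * ε := by
    refine ZeroAtInftyContinuousMap.norm_le_of_forall_norm_apply_le (by positivity) fun t => ?_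
    obtain ⟨ht0, ht1⟩ := hS t.2
    have htri : ‖(a + (r : ℂ) • f) t‖ ≤ t + r * ‖f t‖ := by
      calc ‖(a + (r : ℂ) • f) t‖ ≤ ‖a t‖ + ‖(r : ℂ) * f t‖ := norm_add_le _ _
        _ = t + r * ‖f t‖ := by
          rw [ha, norm_mul, Complex.norm_of_nonneg ht0.le, Complex.norm_of_nonneg hr.le]
    refine htri.trans ?_
    by_cases htδ : dist t ⟨1, h1⟩ < δ
    · have hft := hfδ t htδ
      rw [hf, dist_zero_right] at hft
      gcongr
    · have htδ' : δ ≤ 1 - t := by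
        rw [not_lt, Subtype.dist_eq, dist_comm, Real.dist_eq,
          abs_of_nonneg (sub_nonneg.2 ht1)] at htδ
        exact htδ
      have hft := mul_le_mul_of_nonneg_left (f.norm_apply_le t) hr.le
      have := mul_pos hr hε
      linarith
  have hre : 1 + r * (ψ f).re ≤ 1 + r * ε := by
    calc 1 + r * (ψ f).re = (ψ (a + (r : ℂ) • f)).re := by simp [hψa]
      _ ≤ ‖ψ (a + (r : ℂ) • f)‖ := Complex.re_le_norm _
      _ ≤ 1 * ‖a + (r : ℂ) • f‖ := ψ.le_of_opNorm_le hψ _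
      _ ≤ 1 + r * ε := by rwa [one_mul]
  have : (ψ f).re ≤ ε := le_of_mul_le_mul_left (by linarith) hr
  linarith

theorem functional_eq_apply_one
    {S : Set ℝ} (hS : S ⊆ Set.Ioc 0 1) (h1 : (1 : ℝ) ∈ S)
    {a : C₀(S, ℂ)} (ha : ∀ t : S, a t = ((t : ℝ) : ℂ))
    {ψ : C₀(S, ℂ) →L[ℂ] ℂ} (hψ : ‖ψ‖ ≤ 1) (hψa : ψ a = 1) (f : C₀(S, ℂ)) :
    ψ f = f ⟨1, h1⟩ := by
  set g : C₀(S, ℂ) := f - f ⟨1, h1⟩ • a with hg_def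
  have hg : g ⟨1, h1⟩ = 0 := by simp [hg_def, ha]
  have hψg : ψ g = 0 := by
    have := re_functional_nonpos_of_apply_one_eq_zero hS h1 ha hψ hψa
      (f := (starRingEnd ℂ) (ψ g) • g) (by simp [hg])
    rw [map_smul, smul_eq_mul, mul_comm, Complex.mul_conj, Complex.ofReal_re] at this
    exact Complex.normSq_eq_zero.1 (this.antisymm (Complex.normSq_nonneg _))
  simpa [hg_def, hψa, sub_eq_zero] using hψg

/-- Proposition `p Royden`: if `S ⊆ (0,1]` with `1 ∈ S` and
`S ∪ {0}` compact, `a ∈ C₀(S,ℂ)` is the function `t ↦ t`, and `ψ` is a continuous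
linear functional on `C₀(S,ℂ)` with `‖ψ‖ = 1` and `ψ(a) = 1`, then `ψ` is a triple
homomorphism for the triple product `{f,g,h} = f·conj(g)·h`. -/
theorem functional_is_triple_homomorphism
    (S : Set ℝ) (hS : S ⊆ Set.Ioc 0 1) (h1 : (1 : ℝ) ∈ S)
    (hcomp : IsCompact (S ∪ {0}))
    (a : C₀(S, ℂ)) (ha : ∀ t : S, a t = ((t : ℝ) : ℂ))
    (ψ : C₀(S, ℂ) →L[ℂ] ℂ) (hψ : ‖ψ‖ = 1) (hψa : ψ a = 1) :
    ∀ f g h : C₀(S, ℂ),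
      ψ (f * star g * h) = ψ f * (starRingEnd ℂ) (ψ g) * ψ h := by
  intro f g h
  simp [functional_eq_apply_one hS h1 ha hψ.le hψa]
end

section
/- Let ψ be a continuous linear functional on C₀(S,ℂ) with ‖ψ‖ = 1 and ψ(a) = 1, where a(t) = t. Then the positive semidefinite sesquilinear form (f|g)_ψ := ψ(f·conj(g)·a) on C₀(S,ℂ) satisfies (a|a)_ψ = 1, i.e. ψ(a·conj(a)·a) = ψ(t ↦ t³) = 1. -/
open ZeroAtInfty

/-- If the point `1` stays in the closed unit disc under all perturbations `w * z` with
`‖w‖ ≤ r`, then `z = 0`. -/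
theorem Complex.eq_zero_of_forall_norm_one_add_mul_le {r : ℝ} (hr : 0 < r) {z : ℂ}
    (h : ∀ w : ℂ, ‖w‖ ≤ r → ‖1 + w * z‖ ≤ 1) : z = 0 := by
  by_contra hz
  have hz' : 0 < ‖z‖ := norm_pos_iff.2 hz
  have hw : ‖((r / ‖z‖ : ℝ) : ℂ) * star z‖ ≤ r := by
    rw [norm_mul, norm_star, Complex.norm_real, Real.norm_of_nonneg (by positivity)]
    exact (div_mul_cancel₀ r hz'.ne').le
  have key := (Complex.re_le_norm _).trans (h _ hw)
  have hzz : star z * z = ((‖z‖ ^ 2 : ℝ) : ℂ) := by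
    rw [Complex.star_def, Complex.conj_mul']
    push_cast
    rfl
  rw [mul_assoc, hzz, ← Complex.ofReal_mul, Complex.add_re, Complex.one_re,
    Complex.ofReal_re] at key
  have : 0 < r / ‖z‖ * ‖z‖ ^ 2 := by positivity
  linarith

/-- The function `t ↦ t + w * (t - t ^ 3)` maps `[0, 1]` into the unit disc when `‖w‖ ≤ 1 / 2`. -/
theorem norm_ofReal_add_mul_sub_cube_le_one {t : ℝ} (h0 : 0 ≤ t) (h1 : t ≤ 1) {w : ℂ}
    (hw : ‖w‖ ≤ 1 / 2) : ‖(t : ℂ) + w * ((t : ℂ) - (t : ℂ) ^ 3)‖ ≤ 1 := by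
  have hnn : 0 ≤ t - t ^ 3 := by nlinarith [mul_nonneg h0 (sub_nonneg.2 h1)]
  have hn : ‖(t : ℂ) - (t : ℂ) ^ 3‖ = t - t ^ 3 := by
    rw [← Complex.ofReal_pow, ← Complex.ofReal_sub, Complex.norm_real, Real.norm_of_nonneg hnn]
  calc ‖(t : ℂ) + w * ((t : ℂ) - (t : ℂ) ^ 3)‖
      ≤ ‖(t : ℂ)‖ + ‖w‖ * ‖(t : ℂ) - (t : ℂ) ^ 3‖ := by
        rw [← norm_mul]
        exact norm_add_le _ _
    _ ≤ t + 1 / 2 * (t - t ^ 3) := by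
        rw [hn, Complex.norm_real, Real.norm_of_nonneg h0]
        gcongr
    _ ≤ 1 := by nlinarith [mul_nonneg (mul_nonneg h0 (sub_nonneg.2 h1)) (sub_nonneg.2 h1),
        mul_nonneg (sub_nonneg.2 h1) (sub_nonneg.2 h1)]

/-- Corollary `c Royden`: if `S ⊆ (0,1]` with `1 ∈ S` and
`S ∪ {0}` compact, `a ∈ C₀(S,ℂ)` is the function `t ↦ t`, and `ψ` is a continuous
linear functional on `C₀(S,ℂ)` with `‖ψ‖ = 1` and `ψ(a) = 1`, then the
prehilbertian seminorm `(f|g)_ψ = ψ(f·conj(g)·a)` satisfies `(a|a)_ψ = 1`, i.e.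
`ψ(a·conj(a)·a) = ψ(t ↦ t³) = 1`. -/
theorem seminorm_at_a_eq_one
    (S : Set ℝ) (hS : S ⊆ Set.Ioc 0 1) (h1 : (1 : ℝ) ∈ S)
    (hcomp : IsCompact (S ∪ {0}))
    (a : C₀(S, ℂ)) (ha : ∀ t : S, a t = ((t : ℝ) : ℂ))
    (ψ : C₀(S, ℂ) →L[ℂ] ℂ) (hψ : ‖ψ‖ = 1) (hψa : ψ a = 1) :
    ψ (a * star a * a) = 1 := by
  have hzero : ψ (a - a * star a * a) = 0 := by
    refine Complex.eq_zero_of_forall_norm_one_add_mul_le (r := 1 / 2) (by norm_num) fun w hw => ?_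
    have hnorm : ‖a + w • (a - a * star a * a)‖ ≤ 1 := by
      rw [← ZeroAtInftyContinuousMap.norm_toBCF_eq_norm]
      refine (BoundedContinuousFunction.norm_le zero_le_one).2 fun t => ?_
      have ht := hS t.2
      have hval : (a + w • (a - a * star a * a)) t =
          ((t : ℝ) : ℂ) + w * (((t : ℝ) : ℂ) - ((t : ℝ) : ℂ) ^ 3) := by
        have hpow : ((t : ℝ) : ℂ) ^ 3 = (t : ℝ) * (t : ℝ) * (t : ℝ) := by ring
        simp [ha, hpow]
      change ‖(a + w • (a - a * star a * a)) t‖ ≤ 1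
      rw [hval]
      exact norm_ofReal_add_mul_sub_cube_le_one ht.1.le ht.2 hw
    have hle := ψ.le_opNorm (a + w • (a - a * star a * a))
    rw [hψ, one_mul, map_add, map_smul, hψa, smul_eq_mul] at hle
    exact hle.trans hnorm
  rw [map_sub, hψa, sub_eq_zero] at hzero
  exact hzero.symm
end
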